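/- arXiv:1812.00472 — 2 statements merged into one kernel-verified Lean document; each statement's English description precedes it below -/
import Mathlib

section
/- For every k ≥ 3 and ℓ ≥ 1, and all sufficiently large n, there exists a k-uniform Berge-K_{1,ℓ}-saturated hypergraph on n vertices with exactly min over a ∈ [n] with C(a−1, k−1) ≤ ℓ−2 of ⌈(ℓ−1)(n−a)/k⌉ + C(a, k) edges. -/
/-- `H` contains a Berge-`K_{1,ℓ}`: a vertex `v`, `ℓ` distinct edges through `v`,
and `ℓ` distinct vertices `u i ≠ v` with `u i` in the `i`-th edge. -/
def BergeStar {V : Type*} (ℓ : ℕ) (H : Finset (Finset V)) : Prop :=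
  ∃ (v : V) (f : Fin ℓ → Finset V) (u : Fin ℓ → V),
    Function.Injective f ∧ Function.Injective u ∧
    ∀ i, f i ∈ H ∧ v ∈ f i ∧ u i ∈ f i ∧ u i ≠ v

namespace BergeAux

set_option linter.unusedSectionVars false

open Finset

/-- Equal, or lying in a common edge. -/
def Near {V : Type*} (L : Finset (Finset V)) (u w : V) : Prop :=
  u = w ∨ ∃ e ∈ L, u ∈ e ∧ w ∈ e

lemma Near.symm {V : Type*} {L : Finset (Finset V)} {u w : V} (h : Near L u w) : Near L w u := by
  rcases h with h | ⟨e, he, h1, h2⟩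
  · exact Or.inl h.symm
  · exact Or.inr ⟨e, he, h2, h1⟩

/-- A linear k-uniform hypergraph with degrees bounded by `c`. -/
structure Good {V : Type*} [DecidableEq V] (k : ℕ) (c : V → ℕ) (L : Finset (Finset V)) : Prop where
  unif : ∀ e ∈ L, e.card = k
  lin : ∀ e ∈ L, ∀ e' ∈ L, ∀ u w, u ≠ w → u ∈ e → w ∈ e → u ∈ e' → w ∈ e' → e = e'
  deg : ∀ v, #{e ∈ L | v ∈ e} ≤ c v

variable {V : Type*} [Fintype V] [DecidableEq V]

/-- closed neighbourhood -/
def nb (L : Finset (Finset V)) (u : V) : Finset V := insert u ({e ∈ L | u ∈ e}.biUnion id)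

lemma mem_nb {L : Finset (Finset V)} {u w : V} : w ∈ nb L u ↔ Near L u w := by
  simp only [nb, Near, mem_insert, mem_biUnion, mem_filter, id]
  constructor
  · rintro (h | ⟨e, ⟨h1, h2⟩, h3⟩)
    · exact Or.inl h.symm
    · exact Or.inr ⟨e, h1, h2, h3⟩
  · rintro (h | ⟨e, h1, h2, h3⟩)
    · exact Or.inl h.symm
    · exact Or.inr ⟨e, ⟨h1, h2⟩, h3⟩

lemma card_nb {k d : ℕ} {c : V → ℕ} {L : Finset (Finset V)} (hL : Good k c L)
    (hc : ∀ v, c v ≤ d) (u : V) : #(nb L u) ≤ 1 + d * k := by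
  have h1 : #({e ∈ L | u ∈ e}.biUnion id) ≤ #{e ∈ L | u ∈ e} * k := by
    apply card_biUnion_le_card_mul
    intro e he
    exact (hL.unif e (mem_filter.1 he).1).le
  have h2 := (hL.deg u).trans (hc u)
  have h3 := card_insert_le u ({e ∈ L | u ∈ e}.biUnion id)
  have h4 := Nat.mul_le_mul_right k h2
  unfold nb
  omega

lemma exists_far {k d : ℕ} {c : V → ℕ} {L : Finset (Finset V)} (hL : Good k c L)
    (hc : ∀ v, c v ≤ d) (K : ℕ) (U : Finset V) (hU : #U ≤ K)
    (hbig : K * (1 + d * k) * (1 + d * k) < #{v | ∃ e ∈ L, v ∈ e}) :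
    ∃ f ∈ L, ∀ u ∈ U, ∀ w ∈ f, ¬ Near L u w := by
  by_contra! hcon
  have hsub : ({v | ∃ e ∈ L, v ∈ e} : Finset V) ⊆ (U.biUnion (nb L)).biUnion (nb L) := by
    intro v hv
    obtain ⟨e, he, hve⟩ := (mem_filter.1 hv).2
    obtain ⟨u, hu, w, hw, hn⟩ := hcon e he
    exact mem_biUnion.2 ⟨w, mem_biUnion.2 ⟨u, hu, mem_nb.2 hn⟩, mem_nb.2 (Or.inr ⟨e, he, hw, hve⟩)⟩
  have h1 := card_le_card hsub
  have h2 : #((U.biUnion (nb L)).biUnion (nb L)) ≤ #(U.biUnion (nb L)) * (1 + d * k) :=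
    card_biUnion_le_card_mul _ _ _ fun u _ => card_nb hL hc u
  have h3 : #(U.biUnion (nb L)) ≤ #U * (1 + d * k) :=
    card_biUnion_le_card_mul _ _ _ fun u _ => card_nb hL hc u
  have h4 : #U * (1 + d * k) * (1 + d * k) ≤ K * (1 + d * k) * (1 + d * k) := by gcongr
  have h5 : #(U.biUnion (nb L)) * (1 + d * k) ≤ #U * (1 + d * k) * (1 + d * k) := by gcongr
  omega

lemma exists_rows {k d : ℕ} {c : V → ℕ} {L : Finset (Finset V)} (hL : Good k c L)
    (hc : ∀ v, c v ≤ d) (hbig : k * k * (1 + d * k) * (1 + d * k) < #{v | ∃ e ∈ L, v ∈ e})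
    (x : Fin k → V) (t : ℕ) (ht : t < k) :
    ∃ p : ℕ → Fin k → V, p 0 = x ∧
      (∀ i, 1 ≤ i → i ≤ t → Function.Injective (p i) ∧ univ.image (p i) ∈ L) ∧
      (∀ i i', i ≤ t → i' ≤ t → i ≠ i' → ∀ j j', ¬ Near L (p i j) (p i' j')) := by
  induction t with
  | zero => exact ⟨fun _ => x, rfl, by intros; omega, by intros; omega⟩
  | succ t ih =>
    obtain ⟨p, hp0, hp1, hp2⟩ := ih (by omega)
    let U : Finset V := (range (t+1)).biUnion fun i => univ.image (p i)
    have hU : #U ≤ k * k := by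
      have : #U ≤ #(range (t+1)) * k := card_biUnion_le_card_mul _ _ _ fun u _ => by
        simpa using (card_image_le (s := (univ : Finset (Fin k))) (f := p u))
      rw [card_range] at this
      exact this.trans (Nat.mul_le_mul_right _ (by omega))
    obtain ⟨f, hf, hfar⟩ := exists_far hL hc (k*k) U hU hbig
    have hfk := hL.unif f hf
    let g : Fin k → V := fun j => (f.equivFinOfCardEq hfk).symm j
    have hg : Function.Injective g := Subtype.val_injective.comp (Equiv.injective _)
    have hgm : ∀ j, g j ∈ f := fun j => ((f.equivFinOfCardEq hfk).symm j).2
    have hgi : univ.image g = f := by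
      apply eq_of_subset_of_card_le
      · intro v hv
        obtain ⟨j, -, rfl⟩ := mem_image.1 hv
        exact hgm j
      · rw [card_image_of_injective _ hg, hfk]; simp
    have hUm : ∀ i ≤ t, ∀ j, p i j ∈ U := fun i hi j =>
      mem_biUnion.2 ⟨i, mem_range.2 (by omega), mem_image_of_mem _ (mem_univ j)⟩
    refine ⟨Function.update p (t+1) g, ?_, ?_, ?_⟩
    · simpa using hp0
    · intro i h1 h2
      by_cases h : i = t + 1
      · subst h; simp only [Function.update_self]; exact ⟨hg, hgi ▸ hf⟩
      · rw [Function.update_of_ne h]; exact hp1 i h1 (by omega)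
    · intro i i' hi hi' hne j j'
      by_cases h : i = t + 1
      · have h' : i' ≠ t + 1 := by omega
        subst h
        rw [Function.update_self, Function.update_of_ne h']
        exact fun hn => hfar _ (hUm i' (by omega) j') _ (hgm j) hn.symm
      · rw [Function.update_of_ne h]
        by_cases h' : i' = t + 1
        · subst h'
          rw [Function.update_self]
          exact hfar _ (hUm i (by omega) j) _ (hgm j')
        · rw [Function.update_of_ne h']
          exact hp2 i i' (by omega) (by omega) hne j j'

lemma step_isolated {k : ℕ} (hk : 1 ≤ k) {c : V → ℕ} {L : Finset (Finset V)} (hL : Good k c L)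
    (hiso : k ≤ #{v | 0 < c v ∧ ¬ ∃ e ∈ L, v ∈ e}) :
    ∃ L' : Finset (Finset V), Good k c L' ∧ #L' = #L + 1 := by
  obtain ⟨S, hS, hSk⟩ := exists_subset_card_eq hiso
  have hS' : ∀ v ∈ S, 0 < c v ∧ ∀ e ∈ L, v ∉ e := by
    intro v hv
    have := (mem_filter.1 (hS hv)).2
    push Not at this
    exact this
  have hSL : S ∉ L := by
    intro h
    obtain ⟨v, hv⟩ := card_pos.1 (show 0 < #S by omega)
    exact (hS' v hv).2 S h hv
  refine ⟨insert S L, ⟨?_, ?_, ?_⟩, card_insert_of_notMem hSL⟩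
  · intro e he
    rcases mem_insert.1 he with rfl | he
    · exact hSk
    · exact hL.unif e he
  · intro e he e' he' u w huw h1 h2 h3 h4
    rcases mem_insert.1 he with h5 | h5 <;> rcases mem_insert.1 he' with h6 | h6
    · rw [h5, h6]
    · exact absurd h3 ((hS' u (h5 ▸ h1)).2 _ h6)
    · exact absurd h1 ((hS' u (h6 ▸ h3)).2 _ h5)
    · exact hL.lin e h5 e' h6 u w huw h1 h2 h3 h4
  · intro v
    by_cases hv : v ∈ S
    · have : ({e ∈ insert S L | v ∈ e} : Finset (Finset V)) ⊆ {S} := by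
        intro e he
        obtain ⟨h1, h2⟩ := mem_filter.1 he
        rcases mem_insert.1 h1 with rfl | h1
        · simp
        · exact absurd h2 ((hS' v hv).2 e h1)
      have h := card_le_card this
      have := (hS' v hv).1
      simp only [card_singleton] at h
      omega
    · rw [filter_insert, if_neg hv]
      exact hL.deg v

lemma step_switch {k : ℕ} (hk : 2 ≤ k) {c : V → ℕ} {L : Finset (Finset V)} (hL : Good k c L)
    (p : ℕ → Fin k → V)
    (hx : ∀ v, #{e ∈ L | v ∈ e} + #{j | p 0 j = v} ≤ c v)
    (hp1 : ∀ i, 1 ≤ i → i < k → Function.Injective (p i) ∧ univ.image (p i) ∈ L)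
    (hp2 : ∀ i i', i < k → i' < k → i ≠ i' → ∀ j j', ¬ Near L (p i j) (p i' j')) :
    ∃ L' : Finset (Finset V), Good k c L' ∧ #L' = #L + 1 := by
  have hrow : ∀ i i', i < k → i' < k → ∀ j j', p i j = p i' j' → i = i' := by
    intro i i' hi hi' j j' h
    by_contra hne
    exact hp2 i i' hi hi' hne j j' (Or.inl h)
  have hcol : ∀ i, 1 ≤ i → i < k → ∀ j j', p i j = p i j' → j = j' :=
    fun i h1 h2 j j' h => (hp1 i h1 h2).1 h
  let C : Fin k → Finset V := fun j => (range k).image fun i => p i j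
  have memC : ∀ v j, v ∈ C j ↔ ∃ i < k, p i j = v := by
    intro v j; simp [C]
  let F : Finset (Finset V) := (Ico 1 k).image fun i => univ.image (p i)
  let Cs : Finset (Finset V) := univ.image C
  have hFL : F ⊆ L := by
    intro e he
    obtain ⟨i, hi, rfl⟩ := mem_image.1 he
    rw [mem_Ico] at hi
    exact (hp1 i hi.1 hi.2).2
  have hCL : ∀ j, C j ∉ L := by
    intro j h
    exact hp2 0 1 (by omega) (by omega) (by omega) j j
      (Or.inr ⟨C j, h, (memC _ _).2 ⟨0, by omega, rfl⟩, (memC _ _).2 ⟨1, by omega, rfl⟩⟩)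
  have hCinj : Function.Injective C := by
    intro j j' h
    have h1 : p 1 j ∈ C j' := h ▸ (memC _ _).2 ⟨1, by omega, rfl⟩
    obtain ⟨i, hi, h2⟩ := (memC _ _).1 h1
    have := hrow _ _ hi (by omega) _ _ h2
    subst this
    exact (hcol 1 le_rfl (by omega) _ _ h2).symm
  have hFcard : #F = k - 1 := by
    rw [card_image_of_injOn]
    · simp
    · intro i hi i' hi' h
      simp only [coe_Ico, Set.mem_Ico] at hi hi'
      have : p i ⟨0, by omega⟩ ∈ univ.image (p i') := by
        have h' : univ.image (p i) = univ.image (p i') := h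
        rw [← h']; exact mem_image_of_mem _ (mem_univ _)
      obtain ⟨j, -, hj⟩ := mem_image.1 this
      exact (hrow _ _ (by omega) (by omega) _ _ hj).symm
  have hCcard : #Cs = k := by
    rw [card_image_of_injective _ hCinj]; simp
  have hdisj : Disjoint (L \ F) Cs := by
    rw [disjoint_left]
    intro e he he'
    obtain ⟨j, -, rfl⟩ := mem_image.1 he'
    exact hCL j (mem_sdiff.1 he).1
  refine ⟨(L \ F) ∪ Cs, ⟨?_, ?_, ?_⟩, ?_⟩
  · intro e he
    rcases mem_union.1 he with he | he
    · exact hL.unif e (mem_sdiff.1 he).1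
    · obtain ⟨j, -, rfl⟩ := mem_image.1 he
      rw [card_image_of_injOn]
      · simp
      · intro i hi i' hi' h
        simp only [coe_range, Set.mem_Iio] at hi hi'
        exact hrow i i' hi hi' _ _ h
  · have key : ∀ e ∈ L, ∀ j, ∀ u w, u ≠ w → u ∈ e → w ∈ e → u ∈ C j → w ∈ C j → False := by
      intro e he j u w huw h1 h2 h3 h4
      obtain ⟨i, hi, rfl⟩ := (memC _ _).1 h3
      obtain ⟨i', hi', rfl⟩ := (memC _ _).1 h4
      have hne : i ≠ i' := by rintro rfl; exact huw rfl
      exact hp2 i i' hi hi' hne j j (Or.inr ⟨e, he, h1, h2⟩)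
    intro e he e' he' u w huw h1 h2 h3 h4
    rcases mem_union.1 he with he | he <;> rcases mem_union.1 he' with he' | he'
    · exact hL.lin e (mem_sdiff.1 he).1 e' (mem_sdiff.1 he').1 u w huw h1 h2 h3 h4
    · obtain ⟨j, -, rfl⟩ := mem_image.1 he'
      exact (key e (mem_sdiff.1 he).1 j u w huw h1 h2 h3 h4).elim
    · obtain ⟨j, -, rfl⟩ := mem_image.1 he
      exact (key e' (mem_sdiff.1 he').1 j u w huw h3 h4 h1 h2).elim
    · obtain ⟨j, -, rfl⟩ := mem_image.1 he
      obtain ⟨j', -, rfl⟩ := mem_image.1 he'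
      obtain ⟨i, hi, rfl⟩ := (memC _ _).1 h1
      obtain ⟨i', hi', rfl⟩ := (memC _ _).1 h2
      have hne : i ≠ i' := by rintro rfl; exact huw rfl
      obtain ⟨a, ha, hae⟩ := (memC _ _).1 h3
      obtain ⟨b, hb, hbe⟩ := (memC _ _).1 h4
      have := hrow _ _ ha hi _ _ hae
      subst this
      have := hrow _ _ hb hi' _ _ hbe
      subst this
      have : j' = j := by
        rcases Nat.eq_zero_or_pos a with h0 | h0
        · exact hcol b (by omega) hb _ _ hbe
        · exact hcol a h0 ha _ _ hae
      rw [this]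
  · intro v
    rw [filter_union]
    refine (card_union_le _ _).trans ?_
    by_cases hv : ∃ i j, 1 ≤ i ∧ i < k ∧ p i j = v
    · obtain ⟨i, j, h1, h2, rfl⟩ := hv
      have hA : #{e ∈ Cs | p i j ∈ e} ≤ 1 := by
        rw [card_le_one]
        have : ∀ e ∈ ({e ∈ Cs | p i j ∈ e} : Finset (Finset V)), e = C j := by
          intro e he
          obtain ⟨h3, h4⟩ := mem_filter.1 he
          obtain ⟨j', -, rfl⟩ := mem_image.1 h3
          obtain ⟨a, ha, hae⟩ := (memC _ _).1 h4
          have := hrow _ _ ha h2 _ _ hae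
          subst this
          rw [hcol a h1 ha _ _ hae]
        intro e he e' he'
        rw [this e he, this e' he']
      have hB : #{e ∈ L \ F | p i j ∈ e} < #{e ∈ L | p i j ∈ e} := by
        apply card_lt_card
        refine ⟨filter_subset_filter _ sdiff_subset, fun h => ?_⟩
        have h3 : univ.image (p i) ∈ ({e ∈ L | p i j ∈ e} : Finset (Finset V)) :=
          mem_filter.2 ⟨(hp1 i h1 h2).2, mem_image_of_mem _ (mem_univ _)⟩
        have h4 := (mem_sdiff.1 (mem_filter.1 (h h3)).1).2
        exact h4 (mem_image.2 ⟨i, mem_Ico.2 ⟨h1, h2⟩, rfl⟩)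
      have := hL.deg (p i j)
      omega
    · have hA : #{e ∈ Cs | v ∈ e} ≤ #{j | p 0 j = v} := by
        have : ({e ∈ Cs | v ∈ e} : Finset (Finset V)) ⊆ ({j | p 0 j = v} : Finset (Fin k)).image C := by
          intro e he
          obtain ⟨h3, h4⟩ := mem_filter.1 he
          obtain ⟨j', -, rfl⟩ := mem_image.1 h3
          obtain ⟨a, ha, hae⟩ := (memC _ _).1 h4
          apply mem_image_of_mem
          rcases Nat.eq_zero_or_pos a with h0 | h0
          · subst h0; simpa using hae
          · exact absurd ⟨a, j', h0, ha, hae⟩ hv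
        exact (card_le_card this).trans card_image_le
      have hB : #{e ∈ L \ F | v ∈ e} ≤ #{e ∈ L | v ∈ e} :=
        card_le_card (filter_subset_filter _ sdiff_subset)
      have := hx v
      omega
  · rw [card_union_of_disjoint hdisj, card_sdiff_of_subset hFL, hFcard, hCcard]
    have := card_le_card hFL
    omega

lemma sum_deg {k : ℕ} {c : V → ℕ} {L : Finset (Finset V)} (hL : Good k c L) :
    ∑ v, #{e ∈ L | v ∈ e} = k * #L := by
  have h := sum_card_bipartiteAbove_eq_sum_card_bipartiteBelow (s := (univ : Finset V)) (t := L)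
    (fun v e => v ∈ e)
  simp only [bipartiteAbove, bipartiteBelow] at h
  rw [h, sum_congr rfl (g := fun _ => k)]
  · simp [mul_comm]
  · intro e he
    rw [← hL.unif e he]; congr 1; ext; simp

lemma exists_x {k : ℕ} (g : V → ℕ) (h : k ≤ ∑ v, g v) :
    ∃ x : Fin k → V, ∀ v, #{j | x j = v} ≤ g v := by
  have hc : Fintype.card (Fin k) ≤ Fintype.card (Σ v : V, Fin (g v)) := by simpa using h
  obtain ⟨φ⟩ := Function.Embedding.nonempty_of_card_le hc
  refine ⟨fun j => (φ j).1, fun v => ?_⟩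
  have h1 : (({j | (φ j).1 = v} : Finset (Fin k)).map φ) ⊆
      (univ : Finset (Fin (g v))).image (fun i => (⟨v, i⟩ : Σ v : V, Fin (g v))) := by
    intro s hs
    obtain ⟨j, hj, rfl⟩ := mem_map.1 hs
    have hj := (mem_filter.1 hj).2
    generalize φ j = s at hj
    obtain ⟨a, b⟩ := s
    subst hj
    exact mem_image_of_mem _ (mem_univ b)
  have h2 := (card_le_card h1).trans card_image_le
  simpa using h2

lemma exists_good {k d : ℕ} (hk : 2 ≤ k) {c : V → ℕ} (hc : ∀ v, c v ≤ d)
    (hbig : k + k * k * (1 + d * k) * (1 + d * k) < #{v | 0 < c v}) (E : ℕ)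
    (hE : k * E ≤ ∑ v, c v) : ∃ L : Finset (Finset V), Good k c L ∧ #L = E := by
  induction E with
  | zero => exact ⟨∅, ⟨by simp, by simp, by simp⟩, by simp⟩
  | succ E ih =>
    rw [mul_add, mul_one] at hE
    obtain ⟨L, hL, rfl⟩ := ih (by omega)
    by_cases hiso : k ≤ #{v | 0 < c v ∧ ¬ ∃ e ∈ L, v ∈ e}
    · exact step_isolated (by omega) hL hiso
    · have hbig' : k * k * (1 + d * k) * (1 + d * k) < #{v | ∃ e ∈ L, v ∈ e} := by
        have hs : ({v | 0 < c v} : Finset V) ⊆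
            ({v | 0 < c v ∧ ¬ ∃ e ∈ L, v ∈ e} : Finset V) ∪ ({v | ∃ e ∈ L, v ∈ e} : Finset V) := by
          intro v hv
          by_cases h : ∃ e ∈ L, v ∈ e
          · exact mem_union_right _ (by simpa using h)
          · apply mem_union_left
            simp only [mem_filter, mem_univ, true_and] at hv ⊢
            exact ⟨hv, h⟩
        have := (card_le_card hs).trans (card_union_le _ _)
        omega
      have hsum : k ≤ ∑ v, (c v - #{e ∈ L | v ∈ e}) := by
        have h1 : ∑ v, (c v - #{e ∈ L | v ∈ e}) + ∑ v, #{e ∈ L | v ∈ e} = ∑ v, c v := by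
          rw [← sum_add_distrib]
          exact sum_congr rfl fun v _ => Nat.sub_add_cancel (hL.deg v)
        rw [sum_deg hL] at h1
        omega
      obtain ⟨x, hx⟩ := exists_x _ hsum
      obtain ⟨p, hp0, hp1, hp2⟩ := exists_rows hL hc hbig' x (k-1) (by omega)
      refine step_switch hk hL p ?_ ?_ ?_
      · intro v
        have h1 := hx v
        have h2 := hL.deg v
        rw [hp0]
        omega
      · exact fun i h1 h2 => hp1 i h1 (by omega)
      · exact fun i i' h1 h2 => hp2 i i' (by omega) (by omega)

lemma exists_exact {k d : ℕ} (hk : 2 ≤ k) {c : V → ℕ} (hc : ∀ v, c v ≤ d)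
    (hbig : k + k * k * (1 + d * k) * (1 + d * k) < #{v | 0 < c v}) (E : ℕ)
    (hE : k * E = ∑ v, c v) : ∃ L : Finset (Finset V), Good k c L ∧ #L = E ∧
      ∀ v, #{e ∈ L | v ∈ e} = c v := by
  obtain ⟨L, hL, hLE⟩ := exists_good hk hc hbig E hE.le
  refine ⟨L, hL, hLE, ?_⟩
  have h := sum_deg hL
  rw [hLE, hE] at h
  intro v
  exact (sum_eq_sum_iff_of_le (fun v _ => hL.deg v)).1 h v (mem_univ v)

lemma choose_bound (r t : ℕ) (hr : 1 ≤ r) : t + 1 ≤ Nat.choose (t + r) r := by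
  induction t with
  | zero => simp
  | succ t ih =>
    obtain ⟨r, rfl⟩ : ∃ s, r = s + 1 := ⟨r - 1, by omega⟩
    have h1 : t + 1 + (r + 1) = (t + r + 1) + 1 := by ring
    rw [h1, Nat.choose_succ_succ]
    have h2 : 0 < Nat.choose (t + r + 1) r := Nat.choose_pos (by omega)
    have h3 : t + (r + 1) = t + r + 1 := by ring
    rw [h3] at ih
    simp only [Nat.succ_eq_add_one]
    omega

lemma no_star {ℓ : ℕ} (H : Finset (Finset V)) (h : ∀ v, #{e ∈ H | v ∈ e} < ℓ) :
    ¬ BergeStar ℓ H := by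
  rintro ⟨v, f, u, hf, -, hfu⟩
  have h1 : univ.image f ⊆ ({e ∈ H | v ∈ e} : Finset (Finset V)) := by
    intro e he
    obtain ⟨i, -, rfl⟩ := mem_image.1 he
    exact mem_filter.2 ⟨(hfu i).1, (hfu i).2.1⟩
  have h2 := card_le_card h1
  rw [card_image_of_injective _ hf] at h2
  have := h v
  simp at h2
  omega

lemma star {k ℓ : ℕ} (hk : 3 ≤ k) {c : V → ℕ} (H L : Finset (Finset V)) (hLH : L ⊆ H)
    (hL : Good k c L) (v : V) (hv : #{e ∈ L | v ∈ e} + 1 = ℓ) (e : Finset V) (he : e.card = k)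
    (heH : e ∉ H) (hve : v ∈ e) : BergeStar ℓ (insert e H) := by
  obtain ⟨d, hd⟩ : ∃ d, #{e ∈ L | v ∈ e} = d := ⟨_, rfl⟩
  rw [hd] at hv
  subst hv
  obtain ⟨x, hx⟩ := card_pos.1 (show 0 < #(e.erase v) by rw [card_erase_of_mem hve]; omega)
  rw [mem_erase] at hx
  let g : Fin d → Finset V := fun i => (({e ∈ L | v ∈ e} : Finset (Finset V)).equivFinOfCardEq hd).symm i
  have hg : Function.Injective g := Subtype.val_injective.comp (Equiv.injective _)
  have hgm : ∀ i, g i ∈ L ∧ v ∈ g i := fun i => mem_filter.1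
    ((({e ∈ L | v ∈ e} : Finset (Finset V)).equivFinOfCardEq hd).symm i).2
  have hu : ∀ i, ∃ u, u ∈ g i ∧ u ≠ v ∧ u ≠ x := by
    intro i
    have h1 := hL.unif _ (hgm i).1
    have h2 : #(g i) ≤ #(((g i).erase v).erase x) + 2 := by
      have := pred_card_le_card_erase (s := g i) (a := v)
      have := pred_card_le_card_erase (s := (g i).erase v) (a := x)
      omega
    obtain ⟨u, hu⟩ := card_pos.1 (show 0 < #(((g i).erase v).erase x) by omega)
    simp only [mem_erase] at hu
    exact ⟨u, hu.2.2, hu.2.1, hu.1⟩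
  choose u hu1 hu2 hu3 using hu
  refine ⟨v, Fin.cons e g, Fin.cons x u, ?_, ?_, ?_⟩
  · rw [Fin.cons_injective_iff]
    refine ⟨?_, hg⟩
    rintro ⟨i, rfl⟩
    exact heH (hLH (hgm i).1)
  · rw [Fin.cons_injective_iff]
    refine ⟨?_, ?_⟩
    · rintro ⟨i, hi⟩
      exact hu3 i hi
    · intro i j hij
      apply hg
      exact hL.lin _ (hgm i).1 _ (hgm j).1 v (u i) (hu2 i).symm (hgm i).2 (hu1 i) (hgm j).2
        (hij ▸ hu1 j)
  · intro i
    refine Fin.cases ?_ ?_ i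
    · exact ⟨by simp, by simpa using hve, by simpa using hx.2, by simpa using hx.1⟩
    · intro i
      simp only [Fin.cons_succ]
      exact ⟨mem_insert_of_mem (hLH (hgm i).1), (hgm i).2, hu1 i, hu2 i⟩

lemma clique_deg {k : ℕ} (A : Finset V) (v : V) (hv : v ∈ A) :
    #{e ∈ powersetCard k A | v ∈ e} ≤ Nat.choose (#A - 1) (k - 1) := by
  rw [← card_erase_of_mem hv, ← card_powersetCard]
  apply card_le_card_of_injOn (fun e => e.erase v)
  · intro e he
    have he := mem_filter.1 (mem_coe.1 he)
    rw [mem_powersetCard] at he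
    rw [mem_coe, mem_powersetCard, card_erase_of_mem he.2, he.1.2]
    exact ⟨erase_subset_erase _ he.1.1, rfl⟩
  · intro e he e' he' h
    have he := mem_filter.1 (mem_coe.1 he)
    have he' := mem_filter.1 (mem_coe.1 he')
    have h : e.erase v = e'.erase v := h
    rw [← insert_erase he.2, ← insert_erase he'.2, h]

lemma construct (k d n a : ℕ) (hk : 3 ≤ k) (hd : 1 ≤ d) (ha : k - 1 ≤ a) (han : a ≤ n)
    (hac : Nat.choose (a - 1) (k - 1) ≤ d - 1)
    (hbig : k + k * k * (1 + d * k) * (1 + d * k) < n - a) :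
    ∃ H : Finset (Finset (Fin n)),
      (∀ e ∈ H, e.card = k) ∧
      ¬ BergeStar (d + 1) H ∧
      (∀ e : Finset (Fin n), e.card = k → e ∉ H → BergeStar (d + 1) (insert e H)) ∧
      H.card = Nat.ceil (((d : ℚ) * ((n - a : ℕ) : ℚ)) / (k : ℚ)) + Nat.choose a k := by
  obtain ⟨E, q, hq, hE⟩ : ∃ E q, q < k ∧ k * E = d * (n - a) + q := by
    have h1 := Nat.div_add_mod (d * (n - a) + (k - 1)) k
    have h2 := Nat.mod_lt (d * (n - a) + (k - 1)) (show 0 < k by omega)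
    exact ⟨(d * (n - a) + (k - 1)) / k, k - 1 - (d * (n - a) + (k - 1)) % k, by omega, by omega⟩
  have hceil : Nat.ceil (((d : ℚ) * ((n - a : ℕ) : ℚ)) / (k : ℚ)) = E := by
    have hk0 : (0 : ℚ) < k := by exact_mod_cast (show 0 < k by omega)
    have hE' : (k : ℚ) * E = d * ((n - a : ℕ) : ℚ) + q := by exact_mod_cast hE
    have hq' : (q : ℚ) < k := by exact_mod_cast hq
    have hE0 : E ≠ 0 := by
      rintro rfl
      have : 0 < d * (n - a) := Nat.mul_pos hd (by omega)
      omega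
    rw [Nat.ceil_eq_iff hE0]
    have h1 : ((E - 1 : ℕ) : ℚ) = E - 1 := by
      rw [Nat.cast_sub (by omega)]; simp
    rw [h1, lt_div_iff₀ hk0, div_le_iff₀ hk0]
    constructor
    · nlinarith
    · have : (0 : ℚ) ≤ q := by positivity
      nlinarith
  rw [hceil]
  obtain ⟨A, -, hA⟩ := exists_subset_card_eq (s := (univ : Finset (Fin n))) (n := a) (by simpa using han)
  obtain ⟨B, hBA, hB⟩ := exists_subset_card_eq (s := A) (n := q) (by omega)
  let c : Fin n → ℕ := fun v => if v ∈ A then (if v ∈ B then 1 else 0) else d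
  have hcd : ∀ v, c v ≤ d := by
    intro v; simp only [c]; split_ifs <;> omega
  have hcA : #Aᶜ = n - a := by rw [card_compl, hA]; simp
  have hsum : ∑ v, c v = d * (n - a) + q := by
    rw [← sum_add_sum_compl A, add_comm]
    congr 1
    · rw [sum_congr rfl (g := fun _ => d)]
      · simp [← hcA, mul_comm]
      · intro v hv; simp only [c]; rw [if_neg (mem_compl.1 hv)]
    · rw [sum_congr rfl (g := fun v => if v ∈ B then 1 else 0)]
      · rw [← sum_filter, filter_mem_eq_inter, inter_eq_right.2 hBA]; simp [hB]
      · intro v hv; simp only [c]; rw [if_pos hv]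
  have hpos : n - a ≤ #{v | 0 < c v} := by
    rw [← hcA]
    apply card_le_card
    intro v hv
    simp only [mem_filter, mem_univ, true_and, c]
    rw [if_neg (mem_compl.1 hv)]; omega
  obtain ⟨L, hL, hLE, hdeg⟩ := exists_exact (k := k) (d := d) (by omega) hcd (by omega) E (by omega)
  have hnotA : ∀ e ∈ L, ¬ e ⊆ A := by
    intro e he heA
    have : e ⊆ B := by
      intro v hv
      by_contra hvB
      have h1 := hdeg v
      simp only [c] at h1
      rw [if_pos (heA hv), if_neg hvB, card_eq_zero] at h1
      have : e ∈ ({e ∈ L | v ∈ e} : Finset (Finset (Fin n))) := mem_filter.2 ⟨he, hv⟩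
      rw [h1] at this
      simp at this
    have := card_le_card this
    rw [hL.unif e he, hB] at this
    omega
  have hdisj : Disjoint L (powersetCard k A) := by
    rw [disjoint_left]
    intro e he he'
    exact hnotA e he (mem_powersetCard.1 he').1
  refine ⟨L ∪ powersetCard k A, ?_, ?_, ?_, ?_⟩
  · intro e he
    rcases mem_union.1 he with he | he
    · exact hL.unif e he
    · exact (mem_powersetCard.1 he).2
  · apply no_star
    intro v
    rw [filter_union]
    have h1 := card_union_le ({e ∈ L | v ∈ e}) ({e ∈ powersetCard k A | v ∈ e})
    have h2 := hdeg v
    by_cases hv : v ∈ A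
    · have h3 := clique_deg (k := k) A v hv
      rw [hA] at h3
      have h4 : c v ≤ 1 := by
        simp only [c]; rw [if_pos hv]; split_ifs <;> omega
      omega
    · have h3 : #{e ∈ powersetCard k A | v ∈ e} = 0 := by
        rw [card_eq_zero, filter_eq_empty_iff]
        intro e he hve
        exact hv ((mem_powersetCard.1 he).1 hve)
      have := hcd v
      omega
  · intro e he heH
    have : ¬ e ⊆ A := fun h => heH (mem_union_right _ (mem_powersetCard.2 ⟨h, he⟩))
    obtain ⟨v, hve, hvA⟩ := not_subset.1 this
    refine star hk _ L subset_union_left hL v ?_ e he heH hve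
    rw [hdeg v]; simp only [c]; rw [if_neg hvA]
  · rw [card_union_of_disjoint hdisj, hLE, card_powersetCard, hA]

end BergeAux

/-- For `k ≥ 3`, `ℓ ≥ 1` and all sufficiently large `n`, there exists a
`k`-uniform Berge-`K_{1,ℓ}`-saturated hypergraph on `n` vertices with exactly
`min_{a ∈ [n], C(a-1,k-1) ≤ ℓ-2} (⌈(ℓ-1)(n-a)/k⌉ + C(a,k))` edges. -/
theorem berge_star_saturation_upper_bound (k ℓ : ℕ) (hk : 3 ≤ k) (hl : 1 ≤ ℓ) :
    ∃ N : ℕ, ∀ n : ℕ, N ≤ n → ∃ H : Finset (Finset (Fin n)),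
      (∀ e ∈ H, e.card = k) ∧
      ¬ BergeStar ℓ H ∧
      (∀ e : Finset (Fin n), e.card = k → e ∉ H → BergeStar ℓ (insert e H)) ∧
      H.card = sInf {m : ℕ | ∃ a : ℕ, 1 ≤ a ∧ a ≤ n ∧
          Nat.choose (a - 1) (k - 1) ≤ ℓ - 2 ∧
          m = Nat.ceil ((((ℓ - 1 : ℕ) : ℚ) * ((n - a : ℕ) : ℚ)) / (k : ℚ)) +
            Nat.choose a k} := by
  obtain ⟨d, rfl⟩ : ∃ d, ℓ = d + 1 := ⟨ℓ - 1, by omega⟩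
  rcases Nat.eq_zero_or_pos d with rfl | hd
  · refine ⟨1, fun n hn => ⟨∅, by simp, ?_, ?_, ?_⟩⟩
    · rintro ⟨v, f, u, -, -, h⟩
      simpa using (h 0).1
    · intro e he _
      obtain ⟨x, hx, y, hy, hxy⟩ := Finset.one_lt_card.1 (show 1 < e.card by omega)
      refine ⟨x, fun _ => e, fun _ => y, fun i j _ => Fin.ext (by omega),
        fun i j _ => Fin.ext (by omega), fun i => ⟨by simp, hx, hy, hxy.symm⟩⟩
    · symm
      rw [Finset.card_empty, Nat.sInf_eq_zero]
      left
      refine ⟨1, le_rfl, hn, ?_, ?_⟩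
      · rw [Nat.choose_eq_zero_of_lt (by omega)]
      · rw [Nat.choose_eq_zero_of_lt (show 1 < k by omega)]; simp
  · refine ⟨k + d + (k + k * k * (1 + d * k) * (1 + d * k)) + 1, fun n hn => ?_⟩
    simp only [Nat.add_sub_cancel, show d + 1 - 2 = d - 1 by omega]
    set S : Set ℕ := {m : ℕ | ∃ a : ℕ, 1 ≤ a ∧ a ≤ n ∧
          Nat.choose (a - 1) (k - 1) ≤ d - 1 ∧
          m = Nat.ceil (((d : ℚ) * ((n - a : ℕ) : ℚ)) / (k : ℚ)) +
            Nat.choose a k} with hS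
    have hbase : Nat.ceil (((d : ℚ) * ((n - (k - 1) : ℕ) : ℚ)) / (k : ℚ)) +
            Nat.choose (k - 1) k ∈ S :=
      ⟨k - 1, by omega, by omega, by rw [Nat.choose_eq_zero_of_lt (by omega)]; omega, rfl⟩
    obtain ⟨a, ha1, ha2, ha3, ha4⟩ : sInf S ∈ S := Nat.sInf_mem ⟨_, hbase⟩
    obtain ⟨a, ha1, ha2, ha3, ha4⟩ : ∃ a, k - 1 ≤ a ∧ a ≤ n ∧
        Nat.choose (a - 1) (k - 1) ≤ d - 1 ∧
        sInf S = Nat.ceil (((d : ℚ) * ((n - a : ℕ) : ℚ)) / (k : ℚ)) + Nat.choose a k := by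
      by_cases h : k - 1 ≤ a
      · exact ⟨a, h, ha2, ha3, ha4⟩
      · refine ⟨k - 1, le_rfl, by omega, by rw [Nat.choose_eq_zero_of_lt (by omega)]; omega, ?_⟩
        apply le_antisymm (Nat.sInf_le hbase)
        rw [ha4, Nat.choose_eq_zero_of_lt (show k - 1 < k by omega)]
        have h1 : ((n - (k - 1) : ℕ) : ℚ) ≤ ((n - a : ℕ) : ℚ) := by
          exact_mod_cast (show n - (k - 1) ≤ n - a by omega)
        have h2 : Nat.ceil (((d : ℚ) * ((n - (k - 1) : ℕ) : ℚ)) / (k : ℚ)) ≤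
            Nat.ceil (((d : ℚ) * ((n - a : ℕ) : ℚ)) / (k : ℚ)) := by
          apply Nat.ceil_mono
          gcongr
        omega
    rw [ha4]
    have hab : a ≤ k + d := by
      by_contra hcon
      have h1 := BergeAux.choose_bound (k - 1) (a - 1 - (k - 1)) (by omega)
      rw [Nat.sub_add_cancel (by omega)] at h1
      omega
    exact BergeAux.construct k d n a hk hd ha1 ha2 ha3 (by omega)
end

section
/- For all k ≥ 3, ℓ ≥ 1, and all sufficiently large n, the k-uniform Berge star saturation number satisfies sat_k(n, Berge-K_{1,ℓ}) = min over a ∈ [n] with C(a−1, k−1) ≤ ℓ−2 of ⌈(ℓ−1)(n−a)/k⌉ + C(a, k). -/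
/-- The number of `k`-subsets of `A` through a point of `A`. -/
lemma card_powersetCard_through {V : Type*} [DecidableEq V] (A : Finset V) (v : V) (hv : v ∈ A)
    (k : ℕ) (hk : 1 ≤ k) :
    ((A.powersetCard k).filter (fun e => v ∈ e)).card = (A.card - 1).choose (k - 1) := by
  rw [← Finset.card_erase_of_mem hv, ← Finset.card_powersetCard]
  symm
  apply Finset.card_bij (fun e _ => insert v e)
  · intro e he
    rw [Finset.mem_powersetCard] at he
    have hve : v ∉ e := fun h => by simpa using he.1 h
    simp only [Finset.mem_filter, Finset.mem_powersetCard, Finset.mem_insert_self, and_true]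
    refine ⟨Finset.insert_subset hv (he.1.trans (Finset.erase_subset _ _)), ?_⟩
    rw [Finset.card_insert_of_notMem hve, he.2]; omega
  · intro e he e' he' h
    rw [Finset.mem_powersetCard] at he he'
    have hve : v ∉ e := fun h => by simpa using he.1 h
    have hve' : v ∉ e' := fun h => by simpa using he'.1 h
    rw [← Finset.erase_insert hve, h, Finset.erase_insert hve']
  · intro e he
    simp only [Finset.mem_filter, Finset.mem_powersetCard] at he
    refine ⟨e.erase v, ?_, Finset.insert_erase he.2⟩
    rw [Finset.mem_powersetCard, Finset.card_erase_of_mem he.2]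
    exact ⟨Finset.erase_subset_erase _ he.1.1, by omega⟩

/-- A Berge star forces a vertex of degree at least `ℓ`. -/
lemma no_star_of_degree {V : Type*} [DecidableEq V] (ℓ : ℕ) (H : Finset (Finset V))
    (h : ∀ v, (H.filter (fun e => v ∈ e)).card < ℓ) : ¬ BergeStar ℓ H := by
  rintro ⟨v, f, u, hf, -, hfu⟩
  have h1 : (Finset.univ.image f).card ≤ (H.filter (fun e => v ∈ e)).card := by
    apply Finset.card_le_card
    intro e he
    simp only [Finset.mem_image, Finset.mem_univ, true_and] at he
    obtain ⟨i, rfl⟩ := he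
    simp [(hfu i).1, (hfu i).2.1]
  rw [Finset.card_image_of_injective _ hf] at h1
  have := h v
  simp at h1
  omega

/-- Lower bound. -/
lemma lower_bound {n k ℓ : ℕ} (hk : 3 ≤ k) (hl : 1 ≤ ℓ) (hn : 1 ≤ n)
    (H : Finset (Finset (Fin n))) (hu : ∀ e ∈ H, e.card = k) (hns : ¬ BergeStar ℓ H)
    (hs : ∀ e : Finset (Fin n), e.card = k → e ∉ H → BergeStar ℓ (insert e H)) :
    ∃ a : ℕ, 1 ≤ a ∧ a ≤ n ∧ Nat.choose (a - 1) (k - 1) ≤ ℓ - 2 ∧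
      Nat.ceil ((((ℓ - 1 : ℕ) : ℚ) * ((n - a : ℕ) : ℚ)) / (k : ℚ)) + Nat.choose a k ≤ H.card := by
  classical
  set A : Finset (Fin n) :=
    Finset.univ.filter (fun v => (H.filter (fun e => v ∈ e)).card + 1 < ℓ) with hA
  have hAH : A.powersetCard k ⊆ H := by
    intro e he
    rw [Finset.mem_powersetCard] at he
    by_contra heH
    obtain ⟨v, f, u, hf, hui, hfu⟩ := hs e he.2 heH
    by_cases hve : v ∈ e
    · have hvA : v ∈ A := he.1 hve
      simp only [hA, Finset.mem_filter, Finset.mem_univ, true_and] at hvA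
      have h1 : (Finset.univ.image f).card ≤ (insert e (H.filter (fun e => v ∈ e))).card := by
        apply Finset.card_le_card
        intro g hg
        simp only [Finset.mem_image, Finset.mem_univ, true_and] at hg
        obtain ⟨i, rfl⟩ := hg
        have := hfu i
        simp only [Finset.mem_insert, Finset.mem_filter] at this ⊢
        tauto
      rw [Finset.card_image_of_injective _ hf] at h1
      have h2 := Finset.card_insert_le e (H.filter (fun e => v ∈ e))
      simp only [Finset.card_univ, Fintype.card_fin] at h1
      omega
    · apply hns
      refine ⟨v, f, u, hf, hui, fun i => ⟨?_, (hfu i).2⟩⟩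
      have h1 := hfu i
      rcases Finset.mem_insert.1 h1.1 with h | h
      · exact absurd (h ▸ h1.2.1) hve
      · exact h
  set H' := H \ A.powersetCard k with hH'
  have hcard : H'.card + A.card.choose k = H.card := by
    rw [hH', ← Finset.card_powersetCard, Finset.card_sdiff_add_card_eq_card hAH]
  have hcount : (ℓ - 1) * (n - A.card) ≤ H'.card * k := by
    have h1 := Finset.sum_card_bipartiteAbove_eq_sum_card_bipartiteBelow
      (s := Aᶜ) (t := H') (r := fun v e => v ∈ e)
    have h2 : ∑ e ∈ H', (Finset.bipartiteBelow (fun (v : Fin n) e => v ∈ e) Aᶜ e).card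
        ≤ H'.card * k := by
      rw [← smul_eq_mul]
      apply Finset.sum_le_card_nsmul
      intro e he
      rw [← hu e (Finset.mem_sdiff.1 he).1]
      apply Finset.card_le_card
      intro v hv
      simp [Finset.bipartiteBelow] at hv
      exact hv.2
    have h3 : Aᶜ.card * (ℓ - 1) ≤
        ∑ v ∈ Aᶜ, (Finset.bipartiteAbove (fun (v : Fin n) e => v ∈ e) H' v).card := by
      rw [← smul_eq_mul]
      apply Finset.card_nsmul_le_sum
      intro v hv
      have hv' : v ∉ A := by simpa using hv
      have h4 : Finset.bipartiteAbove (fun (v : Fin n) e => v ∈ e) H' v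
          = H.filter (fun e => v ∈ e) := by
        ext e
        simp only [Finset.bipartiteAbove, hH', Finset.mem_filter, Finset.mem_sdiff,
          Finset.mem_powersetCard]
        constructor
        · tauto
        · rintro ⟨h5, h6⟩
          exact ⟨⟨h5, fun h7 => hv' (h7.1 h6)⟩, h6⟩
      rw [h4]
      simp only [hA, Finset.mem_filter, Finset.mem_univ, true_and] at hv'
      omega
    rw [Finset.card_compl, Fintype.card_fin] at h3
    rw [mul_comm]
    omega
  have hkq : (0 : ℚ) < k := by exact_mod_cast (by omega : 0 < k)
  have hceil : ∀ x : ℕ, (ℓ - 1) * x ≤ H'.card * k →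
      Nat.ceil ((((ℓ - 1 : ℕ) : ℚ) * (x : ℚ)) / (k : ℚ)) ≤ H'.card := by
    intro x hx
    rw [Nat.ceil_le, div_le_iff₀ hkq]
    exact_mod_cast hx
  rcases A.eq_empty_or_nonempty with h0 | ⟨v, hv⟩
  · refine ⟨1, le_rfl, hn, ?_, ?_⟩
    · rw [Nat.choose_eq_zero_of_lt (by omega)]; omega
    · rw [Nat.choose_eq_zero_of_lt (by omega)]
      have h1 := hceil (n - 1) (by
        refine le_trans (Nat.mul_le_mul_left _ ?_) hcount
        rw [h0]; simp)
      omega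
  · have hA1 : 1 ≤ A.card := Finset.card_pos.2 ⟨v, hv⟩
    refine ⟨A.card, hA1, by simpa using Finset.card_le_univ A, ?_, ?_⟩
    · rw [← card_powersetCard_through A v hv k (by omega)]
      have h1 := Finset.card_le_card (Finset.filter_subset_filter (fun e => v ∈ e) hAH)
      simp only [hA, Finset.mem_filter, Finset.mem_univ, true_and] at hv
      omega
    · have := hceil _ hcount
      omega

/-- Completing a linear star with an arbitrary new edge. -/
lemma star_of_linear {V : Type*} [DecidableEq V] (d : ℕ) (H : Finset (Finset V)) (w : V)
    (f : Fin d → Finset V) (hf : ∀ i, f i ∈ H) (hw : ∀ i, w ∈ f i) (hc : ∀ i, 3 ≤ (f i).card)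
    (hd : ∀ i j, i ≠ j → ∀ x, x ∈ f i → x ∈ f j → x = w)
    (e : Finset V) (he : e ∉ H) (hwe : w ∈ e) (hec : 2 ≤ e.card) :
    BergeStar (d + 1) (insert e H) := by
  obtain ⟨x, hx, hxw⟩ : ∃ x ∈ e, x ≠ w := by
    obtain ⟨x, hx, hxw⟩ := Finset.exists_mem_ne (by omega : 1 < e.card) w
    exact ⟨x, hx, hxw⟩
  have h1 : ∀ i, ∃ y ∈ f i, y ≠ w ∧ y ≠ x := by
    intro i
    have : 0 < ((f i) \ {w, x}).card := by
      have h2 := Finset.le_card_sdiff {w, x} (f i)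
      have h3 := Finset.card_le_two (a := w) (b := x)
      have := hc i
      omega
    obtain ⟨y, hy⟩ := Finset.card_pos.1 this
    simp at hy
    exact ⟨y, hy.1, hy.2.1, hy.2.2⟩
  choose u hu huw hux using h1
  have huinj : Function.Injective u := by
    intro i j hij
    by_contra hne
    exact huw i (hd i j hne _ (hu i) (hij ▸ hu j))
  have hfinj : Function.Injective f := by
    intro i j hij
    by_contra hne
    exact huw i (hd i j hne _ (hu i) (hij ▸ hu i))
  refine ⟨w, Fin.cons e f, Fin.cons x u, ?_, ?_, ?_⟩
  · rw [Fin.cons_injective_iff]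
    refine ⟨?_, hfinj⟩
    rintro ⟨i, rfl⟩
    exact he (hf i)
  · rw [Fin.cons_injective_iff]
    refine ⟨?_, huinj⟩
    rintro ⟨i, hi⟩
    exact hux i hi
  · intro i
    refine Fin.cases ?_ (fun i => ?_) i
    · simp [hwe, hx, hxw]
    · simp [hw, hu, huw, hf]

/-- Labels. -/
noncomputable def gridLab (q s d k : ℕ) [NeZero k] [NeZero d] (g : Fin s × Fin d → Fin q) (bl : Fin s × Fin d → ℕ) :
    ((Fin q × (Fin d → Fin k)) ⊕ Fin s) → Fin d → (Fin q × Fin d × (Fin d → Fin k)) ⊕ ℕ :=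
  open Classical in
  fun v i => match v with
  | Sum.inl (c, x) => if h : x = 0 ∧ i = 0 ∧ ∃ u, g u = c then Sum.inr (bl h.2.2.choose)
      else Sum.inl (c, i, Function.update x i 0)
  | Sum.inr w => Sum.inl (g (w, i), 0, 0)

lemma gridLab_inj (q s d k : ℕ) [NeZero k] [NeZero d] (g : Fin s × Fin d → Fin q)
    (hg : Function.Injective g) (bl : Fin s × Fin d → ℕ) (v) :
    Function.Injective (gridLab q s d k g bl v) := by
  intro i j hij
  rcases v with ⟨c, x⟩ | w
  · simp only [gridLab] at hij
    split_ifs at hij with h1 h2 h2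
    · rw [h1.2.1, h2.2.1]
    · simp at hij; exact hij.1
  · simp only [gridLab, Sum.inl.injEq, Prod.mk.injEq, and_true] at hij
    have := hg hij
    simpa using this

lemma gridLab_linear (q s d k : ℕ) [NeZero k] [NeZero d] (g : Fin s × Fin d → Fin q)
    (hg : Function.Injective g) (bl : Fin s × Fin d → ℕ) (v v') (hv : v ≠ v') (i i' j j')
    (h1 : gridLab q s d k g bl v i = gridLab q s d k g bl v' i')
    (h2 : gridLab q s d k g bl v j = gridLab q s d k g bl v' j') : i = j := by
  rcases v with ⟨c, x⟩ | w <;> rcases v' with ⟨c', x'⟩ | w'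
  · by_contra hij
    simp only [gridLab] at h1 h2
    have key : ∀ i i' : Fin d, Function.update x i 0 = Function.update x' i' 0 → i = i' →
        ∀ t, t ≠ i → x t = x' t := by
      intro i i' h hii t ht
      have := congrFun h t
      subst hii
      simpa [ht] using this
    split_ifs at h1 h2 with a1 a2 a3 a4 a5 a6 a7 <;> simp at h1 h2
    all_goals first
      | (apply hij; simp_all; done)
      | (apply hv; simp_all; done)
      | skip
    apply hv
    have hx : x = x' := by
      funext t
      by_cases ht : t = i
      · exact key j j' h2.2.2 h2.2.1 t (by rw [ht]; exact hij)
      · exact key i i' h1.2.2 h1.2.1 t ht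
    rw [hx, h1.1]
  · simp only [gridLab] at h1 h2
    split_ifs at h1 h2 with a1 a2
    simp at h1 h2
    rw [h1.2.1, h2.2.1]
  · simp only [gridLab] at h1 h2
    split_ifs at h1 h2 with a1 a2
    simp at h1 h2
    have := hg (h1.1.trans h2.1.symm)
    simpa using this
  · simp only [gridLab, Sum.inl.injEq, Prod.mk.injEq, and_true] at h1
    have := hg h1
    simp at this
    exact absurd (by rw [this.1]) hv

/-- fibres of line labels -/
lemma gridLab_line (q s d k : ℕ) [NeZero k] [NeZero d] (g : Fin s × Fin d → Fin q)
    (hg : Function.Injective g) (bl : Fin s × Fin d → ℕ) (c i y)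
    (E : Finset ((Fin q × (Fin d → Fin k)) ⊕ Fin s)) (hy : y i = 0)
    (hE : ∀ v, v ∈ E ↔ ∃ j, gridLab q s d k g bl v j = Sum.inl (c, i, y)) :
    E.card = k := by
  classical
  by_cases hm : y = 0 ∧ i = 0 ∧ ∃ u, g u = c
  · obtain ⟨rfl, rfl, u, rfl⟩ := hm
    have : E = Finset.univ.image (fun t : Fin k =>
        if t = 0 then (Sum.inr u.1 : (Fin q × (Fin d → Fin k)) ⊕ Fin s)
        else Sum.inl (g u, Function.update 0 0 t)) := by
      ext v
      rw [hE]
      simp only [Finset.mem_image, Finset.mem_univ, true_and]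
      constructor
      · rintro ⟨j, hj⟩
        rcases v with ⟨c, x⟩ | w
        · simp only [gridLab] at hj
          split_ifs at hj with h1
          simp only [Sum.inl.injEq, Prod.mk.injEq] at hj
          obtain ⟨rfl, rfl, hx⟩ := hj
          have hx0 : x = Function.update (0 : Fin d → Fin k) 0 (x 0) := by
            rw [← hx]; simp
          have : x 0 ≠ 0 := by
            intro h0
            apply h1
            refine ⟨?_, rfl, u, rfl⟩
            rw [hx0, h0]; simp
          refine ⟨x 0, ?_⟩
          rw [if_neg this, ← hx0]
        · simp only [gridLab, Sum.inl.injEq, Prod.mk.injEq, and_true] at hj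
          have := hg hj
          refine ⟨0, ?_⟩
          rw [if_pos rfl, ← this]
      · rintro ⟨t, rfl⟩
        by_cases ht : t = 0
        · rw [if_pos ht]
          exact ⟨u.2, by simp [gridLab]⟩
        · rw [if_neg ht]
          refine ⟨0, ?_⟩
          simp only [gridLab]
          rw [dif_neg]
          · simp
          · rintro ⟨h, -⟩
            have := congrFun h 0
            simp at this
            exact ht this
    rw [this, Finset.card_image_of_injective]
    · simp
    · intro t t' h
      simp only at h
      split_ifs at h with a b b
      · rw [a, b]
      · simp only [Sum.inl.injEq, Prod.mk.injEq, true_and] at h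
        simpa using congrFun h 0
  · have : E = Finset.univ.image (fun t : Fin k =>
        (Sum.inl (c, Function.update y i t) : (Fin q × (Fin d → Fin k)) ⊕ Fin s)) := by
      ext v
      rw [hE]
      simp only [Finset.mem_image, Finset.mem_univ, true_and]
      constructor
      · rintro ⟨j, hj⟩
        rcases v with ⟨c', x⟩ | w
        · simp only [gridLab] at hj
          split_ifs at hj with h1
          simp only [Sum.inl.injEq, Prod.mk.injEq] at hj
          obtain ⟨rfl, rfl, hx⟩ := hj
          refine ⟨x j, ?_⟩
          rw [← hx]; simp
        · simp only [gridLab, Sum.inl.injEq, Prod.mk.injEq] at hj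
          exact absurd ⟨hj.2.2.symm, hj.2.1.symm, _, hj.1⟩ hm
      · rintro ⟨t, rfl⟩
        refine ⟨i, ?_⟩
        simp only [gridLab]
        have hyy : Function.update y i 0 = y := by rw [← hy]; simp
        rw [dif_neg]
        · simp [hyy]
        · rintro ⟨h, h2⟩
          apply hm
          refine ⟨?_, h2⟩
          rw [← hyy]
          have h3 := congrArg (fun z => Function.update z i 0) h
          simp only [Function.update_idem] at h3
          rw [h3]; simp
    rw [this, Finset.card_image_of_injective]
    · simp
    · intro t t' h
      simp only [Sum.inl.injEq, Prod.mk.injEq, true_and] at h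
      simpa using congrFun h i

/-- fibres of block labels -/
lemma gridLab_block (q s d k : ℕ) [NeZero k] [NeZero d] (g : Fin s × Fin d → Fin q)
    (hg : Function.Injective g) (b : ℕ)
    (E : Finset ((Fin q × (Fin d → Fin k)) ⊕ Fin s))
    (hE : ∀ v, v ∈ E ↔ ∃ j, gridLab q s d k g (fun u => (finProdFinEquiv u).val / k) v j
      = Sum.inr b) :
    E.card ≤ k ∧ ((b + 1) * k ≤ s * d → E.card = k) := by
  classical
  have hk : 0 < k := Nat.pos_of_ne_zero (NeZero.ne k)
  set T : Finset (Fin (s * d)) := Finset.univ.filter (fun t => t.val / k = b) with hT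
  have hEc : E.card = T.card := by
    symm
    apply Finset.card_bij (fun t _ => Sum.inl (g (finProdFinEquiv.symm t), 0))
    · intro t ht
      rw [hE]
      refine ⟨0, ?_⟩
      have hex : (0 : Fin d → Fin k) = 0 ∧ (0 : Fin d) = 0 ∧
        ∃ u, g u = g (finProdFinEquiv.symm t) := ⟨rfl, rfl, _, rfl⟩
      refine (dif_pos hex).trans ?_
      have := hg hex.2.2.choose_spec
      rw [this]
      beta_reduce
      rw [Equiv.apply_symm_apply]
      simpa [hT] using ht
    · intro t _ t' _ h
      simp only [Sum.inl.injEq, Prod.mk.injEq, and_true] at h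
      exact finProdFinEquiv.symm.injective (hg h)
    · intro v hv
      rw [hE] at hv
      obtain ⟨j, hj⟩ := hv
      rcases v with ⟨c, x⟩ | w
      · simp only [gridLab] at hj
        split_ifs at hj with h
        refine ⟨finProdFinEquiv h.2.2.choose, ?_, ?_⟩
        · simpa [hT] using hj
        · rw [Equiv.symm_apply_apply, h.2.2.choose_spec, h.1]
      · simp [gridLab] at hj
  rw [hEc]
  have hI : T.card ≤ (Finset.Ico (b * k) (b * k + k)).card := by
    apply Finset.card_le_card_of_injOn (fun t => t.val)
    · intro t ht
      simp only [hT, Finset.coe_filter, Finset.mem_univ, true_and, Set.mem_ofPred_eq] at ht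
      rw [Nat.div_eq_iff hk] at ht
      simp
      omega
    · intro t _ t' _ h
      exact Fin.ext h
  refine ⟨by simpa using hI, fun hb => ?_⟩
  apply le_antisymm (by simpa using hI)
  have : (Finset.range k).card ≤ T.card := by
    have hlt : ∀ t < k, b * k + t < s * d := by intro t ht; nlinarith
    apply Finset.card_le_card_of_injOn
      (fun t => if h : t < k then (⟨b * k + t, hlt t h⟩ : Fin (s * d)) else ⟨b * k, by
        have := hlt 0 hk; simpa using this⟩)
    · intro t ht
      have ht' : t < k := by simpa using ht
      simp only [ht', dif_pos, hT, Finset.coe_filter, Finset.mem_univ, true_and, Set.mem_ofPred_eq]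
      rw [Nat.div_eq_iff hk]
      omega
    · intro t ht t' ht' h
      have h1 : t < k := by simpa using ht
      have h2 : t' < k := by simpa using ht'
      simp [h1, h2] at h
      exact h
  simpa using this

/-- Existence of nearly `k`-uniform `d`-regular linear hypergraphs on any large vertex set. -/
lemma core (k d : ℕ) (hk : 1 ≤ k) (hd : 1 ≤ d) (V : Type) [Fintype V]
    (hV : k ^ d * (k ^ d * d) ≤ Fintype.card V) :
    ∃ (L : Type) (lab : V → Fin d → L) (l0 : L),
      (∀ v, Function.Injective (lab v)) ∧
      (∀ v v', v ≠ v' → ∀ i i' j j', lab v i = lab v' i' → lab v j = lab v' j' → i = j) ∧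
      (∀ v i, ∀ E : Finset V, (∀ v', v' ∈ E ↔ ∃ j, lab v' j = lab v i) →
        E.card ≤ k ∧ (lab v i ≠ l0 → E.card = k)) := by
  classical
  have : NeZero k := ⟨by omega⟩
  have : NeZero d := ⟨by omega⟩
  set b := Fintype.card V with hb
  have hpos : 0 < k ^ d := Nat.pow_pos (by omega)
  set q := b / k ^ d with hq
  set s := b % k ^ d with hs
  have hqs : s * d ≤ q := by
    rw [hq, Nat.le_div_iff_mul_le hpos]
    refine le_trans ?_ hV
    rw [mul_comm]
    exact Nat.mul_le_mul_left _ (Nat.mul_le_mul_right _ (Nat.mod_lt _ hpos).le)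
  obtain ⟨φ⟩ : Nonempty (V ≃ ((Fin q × (Fin d → Fin k)) ⊕ Fin s)) := by
    rw [← Fintype.card_eq]
    simp only [Fintype.card_sum, Fintype.card_prod, Fintype.card_fin, Fintype.card_fun]
    rw [← hb, hq, hs, Nat.div_add_mod']
  let g : Fin s × Fin d → Fin q := fun u => Fin.castLE hqs (finProdFinEquiv u)
  have hg : Function.Injective g := (Fin.castLE_injective hqs).comp finProdFinEquiv.injective
  let bl : Fin s × Fin d → ℕ := fun u => (finProdFinEquiv u).val / k
  refine ⟨_, fun v => gridLab q s d k g bl (φ v), Sum.inr (s * d / k), ?_, ?_, ?_⟩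
  · intro v
    exact gridLab_inj q s d k g hg bl _
  · intro v v' hv i i' j j' h1 h2
    exact gridLab_linear q s d k g hg bl _ _ (fun h => hv (φ.injective h)) i i' j j' h1 h2
  · intro v i E hE
    rw [← Finset.card_map φ.toEmbedding]
    have hE' : ∀ w, w ∈ E.map φ.toEmbedding ↔
        ∃ j, gridLab q s d k g bl w j = gridLab q s d k g bl (φ v) i := by
      intro w
      rw [Finset.mem_map_equiv, hE]
      simp
    rcases hlab : gridLab q s d k g bl (φ v) i with ⟨c, i', y⟩ | j
    · rw [hlab] at hE'
      have hy : y i' = 0 := by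
        rcases hv : φ v with ⟨c', x⟩ | w
        · rw [hv] at hlab
          simp only [gridLab] at hlab
          split_ifs at hlab with h
          simp only [Sum.inl.injEq, Prod.mk.injEq] at hlab
          obtain ⟨-, rfl, rfl⟩ := hlab
          simp
        · rw [hv] at hlab
          simp only [gridLab, Sum.inl.injEq, Prod.mk.injEq] at hlab
          obtain ⟨-, rfl, rfl⟩ := hlab
          simp
      have := gridLab_line q s d k g hg bl c i' y _ hy hE'
      exact ⟨this.le, fun _ => this⟩
    · rw [hlab] at hE'
      have h1 := gridLab_block q s d k g hg j _ hE'
      refine ⟨h1.1, fun hne => h1.2 ?_⟩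
      have hj : j * k < s * d := by
        rcases hv : φ v with ⟨c', x⟩ | w
        · rw [hv] at hlab
          simp only [gridLab] at hlab
          split_ifs at hlab with h
          simp only [Sum.inr.injEq, bl] at hlab
          have h2 := (finProdFinEquiv h.2.2.choose).isLt
          have h3 := Nat.div_mul_le_self (finProdFinEquiv h.2.2.choose).val k
          rw [hlab] at h3
          omega
        · rw [hv] at hlab
          simp [gridLab] at hlab
      by_contra hcon
      apply hne
      refine hlab.trans ?_
      congr 1
      symm
      rw [Nat.div_eq_iff (by omega)]
      have : (j + 1) * k = j * k + k := by ring
      omega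

/-- Upper bound construction. -/
lemma upper_bound {n k d a : ℕ} (hk : 3 ≤ k) (hd : 1 ≤ d) (hak : k - 1 ≤ a) (han : a ≤ n)
    (hc : Nat.choose (a - 1) (k - 1) ≤ d - 1) (hn : k ^ d * (k ^ d * d) ≤ n - a) :
    ∃ H : Finset (Finset (Fin n)), (∀ e ∈ H, e.card = k) ∧ ¬ BergeStar (d + 1) H ∧
      (∀ e : Finset (Fin n), e.card = k → e ∉ H → BergeStar (d + 1) (insert e H)) ∧
      H.card ≤ Nat.ceil (((d : ℚ) * ((n - a : ℕ) : ℚ)) / (k : ℚ)) + Nat.choose a k := by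
  classical
  obtain ⟨A, -, hA⟩ : ∃ A ⊆ (Finset.univ : Finset (Fin n)), A.card = a :=
    Finset.exists_subset_card_eq (by simpa using han)
  have hVcard : Fintype.card {v : Fin n // v ∉ A} = n - a := by
    rw [Fintype.card_subtype_compl]
    simp [hA]
  obtain ⟨L, lab, l0, hinj, hlin, hfib⟩ :=
    core k d (by omega) hd {v : Fin n // v ∉ A} (by rw [hVcard]; exact hn)
  let E : L → Finset {v : Fin n // v ∉ A} := fun l => Finset.univ.filter (fun v => ∃ j, lab v j = l)
  have hE : ∀ l v, v ∈ E l ↔ ∃ j, lab v j = l := by intro l v; simp [E]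
  let Λ : Finset L := Finset.univ.image (fun p : {v : Fin n // v ∉ A} × Fin d => lab p.1 p.2)
  have hΛ : ∀ l, l ∈ Λ ↔ ∃ v i, lab v i = l := by intro l; simp [Λ]
  have hElek : ∀ l ∈ Λ, (E l).card ≤ k := by
    intro l hl
    obtain ⟨v, i, rfl⟩ := (hΛ l).1 hl
    exact (hfib v i _ (hE _)).1
  have hEk : ∀ l ∈ Λ, l ≠ l0 → (E l).card = k := by
    intro l hl
    obtain ⟨v, i, rfl⟩ := (hΛ l).1 hl
    exact (hfib v i _ (hE _)).2
  have hEpos : ∀ l ∈ Λ, 1 ≤ (E l).card := by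
    intro l hl
    obtain ⟨v, i, rfl⟩ := (hΛ l).1 hl
    exact Finset.card_pos.2 ⟨v, (hE _ _).2 ⟨i, rfl⟩⟩
  obtain ⟨P, hPA, hPc⟩ : ∃ P ⊆ A, l0 ∈ Λ → P.card = k - (E l0).card := by
    by_cases h0 : l0 ∈ Λ
    · have := hEpos l0 h0
      obtain ⟨P, hP, hPc⟩ := Finset.exists_subset_card_eq
        (s := A) (n := k - (E l0).card) (by omega)
      exact ⟨P, hP, fun _ => hPc⟩
    · exact ⟨∅, by simp, fun h => absurd h h0⟩
  let F : L → Finset (Fin n) := fun l =>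
    (E l).map (Function.Embedding.subtype _) ∪ (if l = l0 then P else ∅)
  have hFB : ∀ l (v : Fin n) (hv : v ∉ A), v ∈ F l ↔ ∃ j, lab ⟨v, hv⟩ j = l := by
    intro l v hv
    have hvP : v ∉ (if l = l0 then P else ∅) := by
      split_ifs
      · exact fun h => hv (hPA h)
      · simp
    rw [Finset.mem_union, or_iff_left hvP]
    simp [hE, hv]
  have hFA : ∀ l (v : Fin n), v ∈ A → v ∈ F l → l = l0 := by
    intro l v hv hvF
    by_contra hne
    rw [Finset.mem_union, if_neg hne] at hvF
    simp [hv] at hvF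
  have hFc : ∀ l ∈ Λ, (F l).card = k := by
    intro l hl
    have hdis : Disjoint ((E l).map (Function.Embedding.subtype _)) (if l = l0 then P else ∅) := by
      rw [Finset.disjoint_left]
      intro v hv hvP
      have hvA : v ∉ A := by
        rw [Finset.mem_map] at hv
        obtain ⟨w, -, rfl⟩ := hv
        exact w.2
      split_ifs at hvP
      · exact hvA (hPA hvP)
      · simp at hvP
    rw [Finset.card_union_of_disjoint hdis, Finset.card_map]
    split_ifs with h
    · subst h
      have := hElek l hl
      rw [hPc hl]; omega
    · rw [hEk l hl h]; simp
  have hFnA : ∀ l ∈ Λ, ¬ F l ⊆ A := by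
    intro l hl hsub
    obtain ⟨v, i, rfl⟩ := (hΛ l).1 hl
    exact v.2 (hsub ((hFB _ v.1 v.2).2 ⟨i, rfl⟩))
  have hΛc : k * Λ.card ≤ d * (n - a) + (k - 1) := by
    have h1 : ∑ l ∈ Λ, (E l).card ≤ d * (n - a) := by
      have h2 : (Finset.univ : Finset ({v : Fin n // v ∉ A} × Fin d)).card
          = ∑ l ∈ Λ, (Finset.univ.filter
            (fun p : {v : Fin n // v ∉ A} × Fin d => lab p.1 p.2 = l)).card := by
        apply Finset.card_eq_sum_card_fiberwise
        intro p _
        exact (hΛ _).2 ⟨_, _, rfl⟩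
      rw [Finset.card_univ, Fintype.card_prod, hVcard, Fintype.card_fin] at h2
      rw [mul_comm, h2]
      apply Finset.sum_le_sum
      intro l _
      have h3 : E l = (Finset.univ.filter
            (fun p : {v : Fin n // v ∉ A} × Fin d => lab p.1 p.2 = l)).image Prod.fst := by
        ext v
        rw [hE]
        simp
      rw [h3]
      exact Finset.card_image_le
    have h4 : (Λ.erase l0).card * k ≤ ∑ l ∈ Λ.erase l0, (E l).card := by
      rw [← smul_eq_mul]
      apply Finset.card_nsmul_le_sum
      intro l hl
      rw [Finset.mem_erase] at hl
      exact (hEk l hl.2 hl.1).ge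
    by_cases h0 : l0 ∈ Λ
    · have h5 := Finset.sum_erase_add Λ (fun l => (E l).card) h0
      have h6 := hEpos l0 h0
      have h7 := Finset.card_erase_add_one h0
      rw [← h7, mul_add, mul_comm]
      omega
    · rw [Finset.erase_eq_of_notMem h0] at h4
      rw [mul_comm]
      omega
  have hΛceil : Λ.card ≤ Nat.ceil (((d : ℚ) * ((n - a : ℕ) : ℚ)) / (k : ℚ)) := by
    have hkq : (0 : ℚ) < k := by exact_mod_cast (by omega : 0 < k)
    set c := Nat.ceil (((d : ℚ) * ((n - a : ℕ) : ℚ)) / (k : ℚ)) with hc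
    have h1 : ((d : ℚ) * ((n - a : ℕ) : ℚ)) / (k : ℚ) ≤ c := Nat.le_ceil _
    rw [div_le_iff₀ hkq] at h1
    have h2 : d * (n - a) ≤ c * k := by exact_mod_cast h1
    by_contra hlt
    have h3 : k * (c + 1) ≤ k * Λ.card := Nat.mul_le_mul_left _ (by omega)
    have h4 : k * (c + 1) = c * k + k := by ring
    omega
  refine ⟨A.powersetCard k ∪ Λ.image F, ?_, ?_, ?_, ?_⟩
  · intro e he
    rw [Finset.mem_union, Finset.mem_powersetCard, Finset.mem_image] at he
    rcases he with he | ⟨l, hl, rfl⟩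
    · exact he.2
    · exact hFc l hl
  · apply no_star_of_degree
    intro v
    by_cases hv : v ∈ A
    · have h1 : (A.powersetCard k ∪ Λ.image F).filter (fun e => v ∈ e) ⊆
          insert (F l0) ((A.powersetCard k).filter (fun e => v ∈ e)) := by
        intro e he
        rw [Finset.mem_filter, Finset.mem_union, Finset.mem_image] at he
        rw [Finset.mem_insert, Finset.mem_filter]
        rcases he with ⟨he | ⟨l, hl, rfl⟩, hve⟩
        · exact Or.inr ⟨he, hve⟩
        · left
          rw [hFA l v hv hve]
      have h2 := Finset.card_le_card h1
      have h3 := Finset.card_insert_le (F l0) ((A.powersetCard k).filter (fun e => v ∈ e))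
      rw [card_powersetCard_through A v hv k (by omega), hA] at h3
      omega
    · have h1 : (A.powersetCard k ∪ Λ.image F).filter (fun e => v ∈ e) ⊆
          Finset.univ.image (fun i => F (lab ⟨v, hv⟩ i)) := by
        intro e he
        rw [Finset.mem_filter, Finset.mem_union, Finset.mem_image, Finset.mem_powersetCard] at he
        rw [Finset.mem_image]
        rcases he with ⟨he | ⟨l, hl, rfl⟩, hve⟩
        · exact absurd (he.1 hve) hv
        · obtain ⟨j, hj⟩ := (hFB l v hv).1 hve
          exact ⟨j, Finset.mem_univ _, by rw [hj]⟩
      have h2 := (Finset.card_le_card h1).trans Finset.card_image_le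
      simp only [Finset.card_univ, Fintype.card_fin] at h2
      omega
  · intro e he heH
    obtain ⟨w, hwe, hw⟩ : ∃ w ∈ e, w ∉ A := by
      by_contra hcon
      push Not at hcon
      apply heH
      rw [Finset.mem_union, Finset.mem_powersetCard]
      exact Or.inl ⟨hcon, he⟩
    have hmem : ∀ i, lab ⟨w, hw⟩ i ∈ Λ := fun i => (hΛ _).2 ⟨_, _, rfl⟩
    apply star_of_linear d _ w (fun i => F (lab ⟨w, hw⟩ i)) _ _ _ _ e heH hwe (by omega)
    · intro i
      rw [Finset.mem_union, Finset.mem_image]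
      exact Or.inr ⟨_, hmem i, rfl⟩
    · intro i
      exact (hFB _ w hw).2 ⟨i, rfl⟩
    · intro i
      rw [hFc _ (hmem i)]
      exact hk
    · intro i j hij x hxi hxj
      by_contra hxw
      by_cases hxA : x ∈ A
      · exact hij (hinj _ ((hFA _ x hxA hxi).trans (hFA _ x hxA hxj).symm))
      · obtain ⟨i', hi'⟩ := (hFB _ x hxA).1 hxi
        obtain ⟨j', hj'⟩ := (hFB _ x hxA).1 hxj
        exact hij (hlin ⟨w, hw⟩ ⟨x, hxA⟩ (fun h => hxw (congrArg Subtype.val h).symm)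
          i i' j j' hi'.symm hj'.symm)
  · refine (Finset.card_union_le _ _).trans ?_
    rw [Finset.card_powersetCard, hA]
    have := Finset.card_image_le (s := Λ) (f := F)
    omega

/-- For `k ≥ 3`, `ℓ ≥ 1` and all sufficiently large `n`, the saturation number
`sat_k(n, Berge-K_{1,ℓ})`, i.e. the minimum number of edges of a `k`-uniform
Berge-`K_{1,ℓ}`-saturated hypergraph on `n` vertices, equals
`min_{a ∈ [n], C(a-1,k-1) ≤ ℓ-2} (⌈(ℓ-1)(n-a)/k⌉ + C(a,k))`. -/
theorem berge_star_saturation_number (k ℓ : ℕ) (hk : 3 ≤ k) (hl : 1 ≤ ℓ) :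
    ∃ N : ℕ, ∀ n : ℕ, N ≤ n →
      sInf {m : ℕ | ∃ H : Finset (Finset (Fin n)),
          (∀ e ∈ H, e.card = k) ∧
          ¬ BergeStar ℓ H ∧
          (∀ e : Finset (Fin n), e.card = k → e ∉ H → BergeStar ℓ (insert e H)) ∧
          H.card = m}
      = sInf {m : ℕ | ∃ a : ℕ, 1 ≤ a ∧ a ≤ n ∧
          Nat.choose (a - 1) (k - 1) ≤ ℓ - 2 ∧
          m = Nat.ceil ((((ℓ - 1 : ℕ) : ℚ) * ((n - a : ℕ) : ℚ)) / (k : ℚ)) +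
            Nat.choose a k} := by
  refine ⟨k ^ (ℓ - 1) * (k ^ (ℓ - 1) * (ℓ - 1)) + (k + ℓ) + 1, fun n hn => ?_⟩
  set S := {m : ℕ | ∃ H : Finset (Finset (Fin n)),
          (∀ e ∈ H, e.card = k) ∧
          ¬ BergeStar ℓ H ∧
          (∀ e : Finset (Fin n), e.card = k → e ∉ H → BergeStar ℓ (insert e H)) ∧
          H.card = m} with hS
  set T := {m : ℕ | ∃ a : ℕ, 1 ≤ a ∧ a ≤ n ∧
          Nat.choose (a - 1) (k - 1) ≤ ℓ - 2 ∧
          m = Nat.ceil ((((ℓ - 1 : ℕ) : ℚ) * ((n - a : ℕ) : ℚ)) / (k : ℚ)) +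
            Nat.choose a k} with hT
  have hlow : ∀ m ∈ S, ∃ m' ∈ T, m' ≤ m := by
    rintro m ⟨H, hu, hns, hs, rfl⟩
    obtain ⟨a, h1, h2, h3, h4⟩ := lower_bound hk hl (by omega) H hu hns hs
    exact ⟨_, ⟨a, h1, h2, h3, rfl⟩, h4⟩
  have hup : ∀ m ∈ T, ∃ m' ∈ S, m' ≤ m := by
    rintro m ⟨a, h1, h2, h3, rfl⟩
    rcases Nat.lt_or_ge ℓ 2 with hl2 | hl2
    · obtain rfl : ℓ = 1 := by omega
      refine ⟨0, ⟨∅, by simp, ?_, ?_, by simp⟩, by omega⟩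
      · rintro ⟨v, f, u, -, -, h⟩
        simpa using (h 0).1
      · intro e he _
        obtain ⟨x, hx, y, hy, hxy⟩ := Finset.one_lt_card.1 (by omega : 1 < e.card)
        exact ⟨x, fun _ => e, fun _ => y, fun _ _ _ => Subsingleton.elim _ _,
          fun _ _ _ => Subsingleton.elim _ _, fun _ => ⟨by simp, hx, hy, hxy.symm⟩⟩
    · obtain ⟨d, rfl⟩ : ∃ d, ℓ = d + 1 := ⟨ℓ - 1, by omega⟩
      simp only [Nat.add_sub_cancel] at hn ⊢
      rcases Nat.lt_or_ge a k with hak | hak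
      · obtain ⟨H, hu, hns, hs, hc⟩ := upper_bound (n := n) (k := k) (d := d) (a := k - 1) hk
          (by omega) le_rfl (by omega)
          (by rw [Nat.choose_eq_zero_of_lt (by omega)]; omega) (by omega)
        refine ⟨_, ⟨H, hu, hns, hs, rfl⟩, hc.trans ?_⟩
        rw [Nat.choose_eq_zero_of_lt (by omega : k - 1 < k), Nat.choose_eq_zero_of_lt hak]
        have h5 : ((n - (k - 1) : ℕ) : ℚ) ≤ ((n - a : ℕ) : ℚ) := by
          exact_mod_cast (by omega : n - (k - 1) ≤ n - a)
        gcongr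
      · have hab : a ≤ k + d := by
          by_contra hcon
          have h5 : (k - 1 + d).choose (k - 1) ≤ (a - 1).choose (k - 1) :=
            Nat.choose_le_choose _ (by omega)
          have h6 : (1 + d).choose 1 ≤ (k - 1 + d).choose (k - 1) := by
            rw [Nat.choose_symm_add (a := 1) (b := d), Nat.choose_symm_add (a := k - 1) (b := d)]
            exact Nat.choose_le_choose _ (by omega)
          rw [Nat.choose_one_right] at h6
          omega
        obtain ⟨H, hu, hns, hs, hc⟩ := upper_bound (n := n) (k := k) (d := d) (a := a) hk
          (by omega) (by omega) h2 (by omega) (by omega)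
        exact ⟨_, ⟨H, hu, hns, hs, rfl⟩, hc⟩
  have hTne : T.Nonempty := by
    refine ⟨_, 1, le_rfl, by omega, ?_, rfl⟩
    rw [Nat.choose_eq_zero_of_lt (by omega)]; omega
  have hSne : S.Nonempty := by
    obtain ⟨m, hm⟩ := hTne
    obtain ⟨m', hm', -⟩ := hup m hm
    exact ⟨m', hm'⟩
  apply le_antisymm
  · obtain ⟨m', hm', hle⟩ := hup _ (Nat.sInf_mem hTne)
    exact (Nat.sInf_le hm').trans hle
  · obtain ⟨m', hm', hle⟩ := hlow _ (Nat.sInf_mem hSne)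
    exact (Nat.sInf_le hm').trans hle
end
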